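/- Fix a histogram h : Fin d → ℕ, parameters ε, δ > 0, β ∈ (0,1), a restriction parameter Δ ≥ 1, and integers k ≤ k̄ < d, and let α = ln(k·k̄/β)/ε. Then the probability that the output of prEM_{k,k̄}(h, D_{k̄}(h)) contains some index i (other than ⊥) with h(i) < h_{(k)} − α is at most β. (With probability at least 1 − β the output is (α, k)-accurate: every output index has count at least h_{(k)} − α.) -/

import Mathlib

open scoped BigOperators

/-- The `k`-th largest value among the entries of the histogram `h`. -/
noncomputable def kthLargest {d : ℕ} (h : Fin d → ℕ) (k : ℕ) : ℕ :=
  sSup {v | k ≤ (Finset.univ.filter fun i => v ≤ h i).card}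

/-- Histograms are neighboring if one user's data is added or removed. -/
def Neighbors {d : ℕ} (h h' : Fin d → ℕ) : Prop :=
  (∀ i, h' i ≤ h i ∧ h i ≤ h' i + 1) ∨ (∀ i, h i ≤ h' i ∧ h' i ≤ h i + 1)

/-- `Δ`-restricted-sensitivity neighbors. -/
def RestrictedNeighbors {d : ℕ} (Δ : ℕ) (h h' : Fin d → ℕ) : Prop :=
  Neighbors h h' ∧ (Finset.univ.filter fun i => h i ≠ h' i).card ≤ Δ

/-- The rank of index `i` in the ordering of `h` by decreasing count, ties toward
smaller indices. -/
def histRank {d : ℕ} (h : Fin d → ℕ) (i : Fin d) : ℕ :=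
  (Finset.univ.filter fun j => h i < h j ∨ (h j = h i ∧ j < i)).card

/-- The limited domain `D_k(h)`: the indices of the `k` largest entries of `h`. -/
def limitedDomain {d : ℕ} (h : Fin d → ℕ) (k : ℕ) : Finset (Fin d) :=
  Finset.univ.filter fun i => histRank h i < k

/-- The count `h_⊥ = h_{(k̄+1)} + 1 + ln(min{Δ,k̄}/δ)/ε` assigned to `⊥`. -/
noncomputable def hBot {d : ℕ} (ε δ : ℝ) (Δ kbar : ℕ) (h : Fin d → ℕ) : ℝ :=
  (kthLargest h (kbar + 1) : ℝ) + 1 + Real.log ((min Δ kbar : ℕ) / δ) / ε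

/-- Exponential-mechanism weight of an outcome in `Fin d ∪ {⊥}` (with `⊥ = none`). -/
noncomputable def emWeight {d : ℕ} (ε δ : ℝ) (Δ kbar : ℕ) (h : Fin d → ℕ) :
    Option (Fin d) → ℝ
  | some i => Real.exp (ε * (h i : ℝ))
  | none => Real.exp (ε * hBot ε δ Δ kbar h)

/-- The limited histogram exponential mechanism `ĥEM(h, D)`: probability of outcome `o`
in `D ∪ {⊥}` proportional to its weight. -/
noncomputable def stepProb {d : ℕ} (ε δ : ℝ) (Δ kbar : ℕ) (h : Fin d → ℕ)
    (D : Finset (Fin d)) (o : Option (Fin d)) : ℝ :=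
  emWeight ε δ Δ kbar h o /
    (emWeight ε δ Δ kbar h none + ∑ j ∈ D, emWeight ε δ Δ kbar h (some j))

/-- `prEMProb ε δ Δ kbar h k D l` is the probability that the peeling mechanism
`prEM_{k,k̄}(h, D)` outputs exactly the ordered list `l` (with `⊥ = none`). -/
noncomputable def prEMProb {d : ℕ} (ε δ : ℝ) (Δ kbar : ℕ) (h : Fin d → ℕ) :
    ℕ → Finset (Fin d) → List (Option (Fin d)) → ℝ
  | 0, _, l => if l = [] then 1 else 0
  | _ + 1, D, [none] => stepProb ε δ Δ kbar h D none
  | k + 1, D, some i :: rest =>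
      if i ∈ D then
        stepProb ε δ Δ kbar h D (some i) * prEMProb ε δ Δ kbar h k (D.erase i) rest
      else 0
  | _ + 1, _, _ => 0

section Ranks

variable {d : ℕ} (h : Fin d → ℕ)

theorem histRank_lt_histRank {i j : Fin d} (hij : h j < h i ∨ (h i = h j ∧ i < j)) :
    histRank h i < histRank h j := by
  refine Finset.card_lt_card ⟨fun a ha => ?_, fun hsub => ?_⟩
  · simp only [Finset.mem_filter, Finset.mem_univ, true_and] at ha ⊢
    omega
  · have hi := @hsub i (by simpa using hij)
    simp at hi

theorem histRank_injective : Function.Injective (histRank h) := by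
  intro i j hij
  by_contra hne
  have : (h j < h i ∨ (h i = h j ∧ i < j)) ∨ (h i < h j ∨ (h j = h i ∧ j < i)) := by
    have : i.val ≠ j.val := fun hv => hne (Fin.ext hv)
    omega
  rcases this with hlt | hlt
  · exact absurd hij (histRank_lt_histRank h hlt).ne
  · exact absurd hij (histRank_lt_histRank h hlt).ne'

theorem histRank_lt (i : Fin d) : histRank h i < d := by
  have : histRank h i < (Finset.univ : Finset (Fin d)).card := by
    refine Finset.card_lt_card ⟨Finset.subset_univ _, fun hsub => ?_⟩
    have hi := hsub (Finset.mem_univ i)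
    simp at hi
  simpa using this

theorem card_limitedDomain {k : ℕ} (hk : k ≤ d) : (limitedDomain h k).card = k := by
  have huniv : Finset.univ.image (histRank h) = Finset.range d := by
    refine Finset.eq_of_subset_of_card_le (fun r hr => ?_) ?_
    · obtain ⟨i, -, rfl⟩ := Finset.mem_image.1 hr
      exact Finset.mem_range.2 (histRank_lt h i)
    · rw [Finset.card_image_of_injective _ (histRank_injective h)]
      simp
  have himage : (limitedDomain h k).image (histRank h) = Finset.range k := by
    ext r
    simp only [limitedDomain, Finset.mem_image, Finset.mem_filter, Finset.mem_univ, true_and,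
      Finset.mem_range]
    constructor
    · rintro ⟨i, hi, rfl⟩
      exact hi
    · intro hr
      have hrd : r ∈ Finset.univ.image (histRank h) := by
        rw [huniv]
        exact Finset.mem_range.2 (hr.trans_le hk)
      obtain ⟨i, -, rfl⟩ := Finset.mem_image.1 hrd
      exact ⟨i, hr, rfl⟩
  rw [← Finset.card_image_of_injective _ (histRank_injective h), himage, Finset.card_range]

theorem le_card_kthLargest_le {k : ℕ} (hk : 1 ≤ k) (hkd : k ≤ d) :
    k ≤ (Finset.univ.filter fun i => kthLargest h k ≤ h i).card := by
  refine Nat.sSup_mem (s := {v | k ≤ (Finset.univ.filter fun i => v ≤ h i).card})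
    ⟨0, by simpa using hkd⟩ ⟨∑ i, h i, fun v hv => ?_⟩
  obtain ⟨i, hi⟩ := Finset.card_pos.1 (hk.trans hv)
  exact (Finset.mem_filter.1 hi).2.trans
    (Finset.single_le_sum (f := h) (fun _ _ => Nat.zero_le _) (Finset.mem_univ i))

theorem kthLargest_le_of_mem_limitedDomain {k : ℕ} (hkd : k ≤ d) {i : Fin d}
    (hi : i ∈ limitedDomain h k) : kthLargest h k ≤ h i := by
  have hik : histRank h i < k := (Finset.mem_filter.1 hi).2
  by_contra! hlt
  refine hik.not_ge ((le_card_kthLargest_le h (by omega) hkd).trans (Finset.card_le_card ?_))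
  intro j hj
  simp only [Finset.mem_filter, Finset.mem_univ, true_and] at hj ⊢
  omega

theorem le_card_limitedDomain_filter {k kbar : ℕ} (hkk : k ≤ kbar) (hkd : k ≤ d) :
    k ≤ ((limitedDomain h kbar).filter fun i => kthLargest h k ≤ h i).card := by
  conv_lhs => rw [← card_limitedDomain h hkd]
  refine Finset.card_le_card fun i hi => Finset.mem_filter.2
    ⟨?_, kthLargest_le_of_mem_limitedDomain h hkd hi⟩
  exact Finset.mem_filter.2 ⟨Finset.mem_univ i, (Finset.mem_filter.1 hi).2.trans_le hkk⟩

end Ranks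

section Mechanism

variable {d : ℕ} (ε δ : ℝ) (Δ kbar : ℕ) (h : Fin d → ℕ)

theorem emWeight_pos (o : Option (Fin d)) : 0 < emWeight ε δ Δ kbar h o := by
  cases o <;> exact Real.exp_pos _

theorem emWeight_total_pos (D : Finset (Fin d)) :
    0 < emWeight ε δ Δ kbar h none + ∑ j ∈ D, emWeight ε δ Δ kbar h (some j) :=
  add_pos_of_pos_of_nonneg (emWeight_pos ..)
    (Finset.sum_nonneg fun _ _ => (emWeight_pos ..).le)

theorem stepProb_nonneg (D : Finset (Fin d)) (o : Option (Fin d)) :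
    0 ≤ stepProb ε δ Δ kbar h D o :=
  div_nonneg (emWeight_pos ..).le (emWeight_total_pos ..).le

theorem stepProb_none_add_sum (D : Finset (Fin d)) :
    stepProb ε δ Δ kbar h D none + ∑ i ∈ D, stepProb ε δ Δ kbar h D (some i) = 1 := by
  simp only [stepProb]
  rw [← Finset.sum_div, ← add_div, div_self (emWeight_total_pos ..).ne']

theorem stepProb_le_exp (hε : 0 ≤ ε) {D : Finset (Fin d)} {i j : Fin d} (hj : j ∈ D) {a : ℝ}
    (hij : (h i : ℝ) ≤ h j - a) :
    stepProb ε δ Δ kbar h D (some i) ≤ Real.exp (-(ε * a)) := by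
  rw [stepProb, div_le_iff₀ (emWeight_total_pos ..)]
  have htotal : Real.exp (ε * h j) ≤
      emWeight ε δ Δ kbar h none + ∑ j ∈ D, emWeight ε δ Δ kbar h (some j) :=
    (Finset.single_le_sum (f := fun j => emWeight ε δ Δ kbar h (some j))
      (fun _ _ => (emWeight_pos ..).le) hj).trans
      (le_add_of_nonneg_left (emWeight_pos ..).le)
  refine le_trans ?_ (mul_le_mul_of_nonneg_left htotal (Real.exp_pos _).le)
  rw [← Real.exp_add]
  refine Real.exp_le_exp.2 ?_
  nlinarith [mul_le_mul_of_nonneg_left hij hε]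

theorem prEMProb_succ (n : ℕ) (D : Finset (Fin d)) (l : List (Option (Fin d))) :
    prEMProb ε δ Δ kbar h (n + 1) D l =
      (if l = [none] then stepProb ε δ Δ kbar h D none else 0) +
        ∑ i ∈ D, if l.head? = some (some i) then
          stepProb ε δ Δ kbar h D (some i) * prEMProb ε δ Δ kbar h n (D.erase i) l.tail
          else 0 := by
  rcases l with _ | ⟨_ | i, _ | ⟨b, t⟩⟩ <;> simp [prEMProb]

theorem prEMProb_nonneg (n : ℕ) (D : Finset (Fin d)) (l : List (Option (Fin d))) :
    0 ≤ prEMProb ε δ Δ kbar h n D l := by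
  induction n generalizing D l with
  | zero => rw [prEMProb]; split_ifs <;> norm_num
  | succ n ih =>
    rw [prEMProb_succ]
    refine add_nonneg ?_ (Finset.sum_nonneg fun i _ => ?_)
    · split_ifs
      exacts [stepProb_nonneg .., le_rfl]
    · split_ifs
      exacts [mul_nonneg (stepProb_nonneg ..) (ih ..), le_rfl]

/-- The tails of the lists in `S` whose head is `some i`. -/
def tailsAfter (S : Finset (List (Option (Fin d)))) (i : Fin d) :
    Finset (List (Option (Fin d))) :=
  (S.filter fun l => l.head? = some (some i)).image List.tail

theorem cons_mem_of_mem_tailsAfter {S : Finset (List (Option (Fin d)))} {i : Fin d}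
    {t : List (Option (Fin d))} (ht : t ∈ tailsAfter S i) : some i :: t ∈ S := by
  obtain ⟨l, hl, rfl⟩ := Finset.mem_image.1 ht
  obtain ⟨hl, hhead⟩ := Finset.mem_filter.1 hl
  cases l with
  | nil => simp at hhead
  | cons o t => simp_all

theorem sum_prEMProb_succ (n : ℕ) (D : Finset (Fin d)) (S : Finset (List (Option (Fin d)))) :
    ∑ l ∈ S, prEMProb ε δ Δ kbar h (n + 1) D l =
      (if [none] ∈ S then stepProb ε δ Δ kbar h D none else 0) +
        ∑ i ∈ D, stepProb ε δ Δ kbar h D (some i) *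
          ∑ t ∈ tailsAfter S i, prEMProb ε δ Δ kbar h n (D.erase i) t := by
  simp only [prEMProb_succ, Finset.sum_add_distrib]
  congr 1
  · simp
  · rw [Finset.sum_comm]
    refine Finset.sum_congr rfl fun i _ => ?_
    rw [← Finset.sum_filter, ← Finset.mul_sum, tailsAfter, Finset.sum_image]
    intro l hl l' hl' heq
    have hl := (Finset.mem_filter.1 hl).2
    have hl' := (Finset.mem_filter.1 hl').2
    cases l <;> cases l' <;> simp_all

theorem sum_prEMProb_le_one (n : ℕ) (D : Finset (Fin d)) (S : Finset (List (Option (Fin d)))) :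
    ∑ l ∈ S, prEMProb ε δ Δ kbar h n D l ≤ 1 := by
  induction n generalizing D S with
  | zero => simp only [prEMProb, Finset.sum_ite_eq']; split_ifs <;> norm_num
  | succ n ih =>
    rw [sum_prEMProb_succ, ← stepProb_none_add_sum ε δ Δ kbar h D]
    refine add_le_add ?_ (Finset.sum_le_sum fun i _ => ?_)
    · split_ifs
      exacts [le_rfl, stepProb_nonneg ..]
    · exact mul_le_of_le_one_right (stepProb_nonneg ..) (ih ..)

theorem sum_prEMProb_inaccurate_le (hε : 0 ≤ ε) (m N : ℕ) (a : ℝ) (n : ℕ) (D : Finset (Fin d))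
    (hn : n ≤ (D.filter fun i => m ≤ h i).card) (hD : D.card ≤ N)
    (S : Finset (List (Option (Fin d))))
    (hS : ∀ l ∈ S, ∃ i : Fin d, some i ∈ l ∧ (h i : ℝ) < (m : ℝ) - a) :
    ∑ l ∈ S, prEMProb ε δ Δ kbar h n D l ≤ n * (N * Real.exp (-(ε * a))) := by
  have hq := Real.exp_pos (-(ε * a))
  induction n generalizing D S with
  | zero =>
    refine (Finset.sum_eq_zero fun l hl => ?_).le.trans (by simp)
    obtain ⟨i, hi, -⟩ := hS l hl
    rw [prEMProb, if_neg (List.ne_nil_of_mem hi)]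
  | succ n ih =>
    obtain ⟨j, hj⟩ := Finset.card_pos.1 (n.succ_pos.trans_le hn)
    obtain ⟨hjD, hmj⟩ := Finset.mem_filter.1 hj
    have hmj : (m : ℝ) ≤ h j := by exact_mod_cast hmj
    have hnone : [none] ∉ S := fun hmem => by
      obtain ⟨i, hi, -⟩ := hS _ hmem
      simp at hi
    have hterm : ∀ i ∈ D, stepProb ε δ Δ kbar h D (some i) *
        ∑ t ∈ tailsAfter S i, prEMProb ε δ Δ kbar h n (D.erase i) t ≤
        Real.exp (-(ε * a)) +
          stepProb ε δ Δ kbar h D (some i) * (n * (N * Real.exp (-(ε * a)))) := by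
      intro i hi
      have hstep := stepProb_nonneg ε δ Δ kbar h D (some i)
      by_cases hbad : (h i : ℝ) < (m : ℝ) - a
      · refine (mul_le_of_le_one_right hstep (sum_prEMProb_le_one ..)).trans
          ((stepProb_le_exp ε δ Δ kbar h hε hjD (by linarith)).trans
          (le_add_of_nonneg_right (by positivity)))
      · refine (mul_le_mul_of_nonneg_left (ih _ ?_ ?_ _ fun t ht => ?_) hstep).trans
          (le_add_of_nonneg_left hq.le)
        · rw [Finset.filter_erase]
          exact (Nat.le_sub_one_of_lt hn).trans Finset.pred_card_le_card_erase
        · exact (Finset.card_erase_le).trans hD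
        · obtain ⟨b, hb, hlt⟩ := hS _ (cons_mem_of_mem_tailsAfter ht)
          refine ⟨b, (List.mem_cons.1 hb).resolve_left ?_, hlt⟩
          rintro heq
          cases heq
          exact hbad hlt
    have hsum : ∑ i ∈ D, stepProb ε δ Δ kbar h D (some i) ≤ 1 := by
      rw [← stepProb_none_add_sum ε δ Δ kbar h D]
      exact le_add_of_nonneg_left (stepProb_nonneg ..)
    have hDN : (D.card : ℝ) ≤ N := by exact_mod_cast hD
    rw [sum_prEMProb_succ, if_neg hnone, zero_add]
    calc _ ≤ _ := Finset.sum_le_sum hterm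
      _ = D.card * Real.exp (-(ε * a)) + (∑ i ∈ D, stepProb ε δ Δ kbar h D (some i)) *
            (n * (N * Real.exp (-(ε * a)))) := by
        rw [Finset.sum_add_distrib, Finset.sum_const, nsmul_eq_mul, Finset.sum_mul]
      _ ≤ N * Real.exp (-(ε * a)) + 1 * (n * (N * Real.exp (-(ε * a)))) := by
        gcongr
      _ = _ := by push_cast; ring

end Mechanism

/-- Lemma 21, first part (accuracy): with probability at least `1 − β`, every index output
by `prEM_{k,k̄}(h, D_{k̄}(h))` has count at least `h_{(k)} − α` for `α = ln(k·k̄/β)/ε`;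
i.e. the probability of outputting some index with count below `h_{(k)} − α` is at most `β`. -/
theorem stmt_17 (d : ℕ) (ε δ : ℝ) (hε : 0 < ε) (hδ : 0 < δ) (β : ℝ) (hβ : β ∈ Set.Ioo (0:ℝ) 1)
    (Δ : ℕ) (hΔ : 1 ≤ Δ) (k kbar : ℕ) (hkk : k ≤ kbar) (hkd : kbar < d)
    (h : Fin d → ℕ) :
    ∑' l : {l : List (Option (Fin d)) //
        ∃ i : Fin d, some i ∈ l ∧
          (h i : ℝ) < (kthLargest h k : ℝ) - Real.log ((k : ℝ) * (kbar : ℝ) / β) / ε},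
      prEMProb ε δ Δ kbar h k (limitedDomain h kbar) (l : List (Option (Fin d))) ≤ β := by
  obtain ⟨hβ0, -⟩ := hβ
  have hkd' : k ≤ d := hkk.trans hkd.le
  set a : ℝ := Real.log ((k : ℝ) * (kbar : ℝ) / β) / ε with ha
  have hbound : (k : ℝ) * (kbar * Real.exp (-(ε * a))) ≤ β := by
    rcases Nat.eq_zero_or_pos k with rfl | hk
    · simpa using hβ0.le
    · have hk' : (0 : ℝ) < k := by exact_mod_cast hk
      have hkbar : (0 : ℝ) < kbar := by exact_mod_cast hk.trans_le hkk
      rw [ha, mul_div_cancel₀ _ hε.ne', Real.exp_neg, Real.exp_log (by positivity)]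
      exact le_of_eq (by field_simp)
  refine Real.tsum_le_of_sum_le (fun _ => prEMProb_nonneg ..) fun S => le_trans ?_ hbound
  refine (Finset.sum_map S (Function.Embedding.subtype _)
    (prEMProb ε δ Δ kbar h k (limitedDomain h kbar))).symm.trans_le ?_
  refine sum_prEMProb_inaccurate_le ε δ Δ kbar h hε.le (kthLargest h k) kbar a k _
    (le_card_limitedDomain_filter h hkk hkd') (card_limitedDomain h hkd.le).le _ fun l hl => ?_
  obtain ⟨x, -, rfl⟩ := Finset.mem_map.1 hl
  exact x.2
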